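/- arXiv:1212.5646 — 3 statements merged into one kernel-verified Lean document; each statement's English description precedes it below -/
import Mathlib

section
/- Let n ≥ 1, let τ be a fixed-point-free involution of ZMod (2n) (a chord diagram with n chords), and let I ⊆ ZMod (2n) be a τ-invariant subset consisting of the endpoints of k of the chords. Define the partial surgery permutation p_I : ZMod (2n) → ZMod (2n) by p_I(i) = τ(i+1) if i+1 ∈ I and p_I(i) = i+1 otherwise. Then the number of cycles of p_I equals 1 + k − rank(M(τ)_{I×I}), where M(τ)_{I×I} is the principal submatrix of the interlacement matrix on the rows and columns indexed by I and the rank is taken over ZMod 2. -/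
/-- The setoid on `β` whose classes are the cycles (orbits) of the permutation `p`. -/
def sameCycleSetoid {β : Type*} (p : Equiv.Perm β) : Setoid β where
  r := p.SameCycle
  iseqv := ⟨fun x => Equiv.Perm.SameCycle.refl p x,
    fun h => h.symm, fun h₁ h₂ => h₁.trans h₂⟩

/-- The number of cycles (orbits, including fixed points) of a permutation. -/
noncomputable def cycleCount {β : Type*} (p : Equiv.Perm β) : ℕ :=
  Nat.card (Quotient (sameCycleSetoid p))

/-- `c` lies strictly inside the arc going from `a` (in the positive cyclic direction)
to `τ a`: starting at `a` and moving positively, one reaches `c` strictly before `τ a`. -/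
def StrictlyInsideArc {N : ℕ} (τ : Equiv.Perm (ZMod N)) (a c : ZMod N) : Prop :=
  0 < (c - a).val ∧ (c - a).val < (τ a - a).val

/-- The chords of `τ` through `a` and through `b` have disjoint endpoint sets and are
linked: exactly one of `b`, `τ b` lies strictly inside the arc of `a`. -/
def LinkedAt {N : ℕ} (τ : Equiv.Perm (ZMod N)) (a b : ZMod N) : Prop :=
  b ≠ a ∧ b ≠ τ a ∧ τ b ≠ a ∧ τ b ≠ τ a ∧
    Xor' (StrictlyInsideArc τ a b) (StrictlyInsideArc τ a (τ b))

open Classical in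
/-- The interlacement (intersection) matrix of the chord diagram `τ`, as a matrix
over `ZMod 2` indexed by the points of the circle. -/
noncomputable def interMatrix {N : ℕ} (τ : Equiv.Perm (ZMod N)) :
    Matrix (ZMod N) (ZMod N) (ZMod 2) :=
  Matrix.of fun a b => if LinkedAt τ a b then (1 : ZMod 2) else 0

namespace ChordDiagram

section Cycles

/-- The functions that are constant on the cycles of `p`. -/
def invariantFunctions (K : Type*) [Semiring K] {β : Type*} (p : Equiv.Perm β) :
    Submodule K (β → K) where
  carrier := {f | ∀ i, f (p i) = f i}
  add_mem' hf hg i := by simp [hf i, hg i]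
  zero_mem' _ := rfl
  smul_mem' c f hf i := by simp [hf i]

theorem mem_invariantFunctions {K : Type*} [Semiring K] {β : Type*} {p : Equiv.Perm β}
    {f : β → K} : f ∈ invariantFunctions K p ↔ ∀ i, f (p i) = f i := Iff.rfl

theorem eq_of_sameCycle {α β : Type*} {p : Equiv.Perm β} {f : β → α}
    (hf : ∀ i, f (p i) = f i) {x y : β} (h : p.SameCycle x y) : f x = f y := by
  obtain ⟨z, rfl⟩ := h
  induction z with
  | zero => simp
  | succ m ih => rw [add_comm, zpow_add, zpow_one, Equiv.Perm.mul_apply, hf, ih]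
  | pred m ih =>
    rw [ih, ← hf ((p ^ (-(m : ℤ) - 1)) x), ← Equiv.Perm.mul_apply, ← zpow_one_add]
    congr 3
    ring

/-- Functions on the set of cycles of `p` are the functions constant on cycles. -/
def quotientFunctionsEquiv (K : Type*) [Semiring K] {β : Type*} (p : Equiv.Perm β) :
    (Quotient (sameCycleSetoid p) → K) ≃ₗ[K] invariantFunctions K p where
  toFun g := ⟨fun i => g (Quotient.mk _ i), fun i => congrArg g <|
    Quotient.sound (s := sameCycleSetoid p) ((Equiv.Perm.SameCycle.refl p i).apply_left)⟩
  map_add' _ _ := rfl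
  map_smul' _ _ := rfl
  invFun f := Quotient.lift f.1 fun _ _ h => eq_of_sameCycle f.2 h
  left_inv g := by
    funext q
    induction q using Quotient.inductionOn
    rfl
  right_inv _ := rfl

theorem finrank_invariantFunctions (K : Type*) [Field K] {β : Type*} [Finite β]
    (p : Equiv.Perm β) :
    Module.finrank K (invariantFunctions K p) = cycleCount p := by
  have := Fintype.ofFinite (Quotient (sameCycleSetoid p))
  rw [← (quotientFunctionsEquiv K p).finrank_eq, Module.finrank_fintype_fun_eq_card, cycleCount,
    Nat.card_eq_fintype_card]

end Cycles

variable {N : ℕ}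

theorem val_sub_one_of_ne_zero [NeZero N] (hN : 1 < N) {j : ZMod N} (hj : j ≠ 0) :
    (j - 1).val = j.val - 1 := by
  have h1 : (1 : ZMod N).val = 1 := ZMod.val_one'' (by omega)
  have h0 : j.val ≠ 0 := (ZMod.val_ne_zero j).2 hj
  rw [ZMod.val_sub (by omega), h1]

theorem val_zero_sub_one [NeZero N] : ((0 : ZMod N) - 1).val = N - 1 := by
  obtain ⟨m, rfl⟩ := Nat.exists_eq_succ_of_ne_zero (NeZero.ne N)
  rw [zero_sub, ZMod.val_neg_one, Nat.succ_sub_one]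

theorem val_sub_eq_ite [NeZero N] (a b : ZMod N) :
    (a - b).val = if b.val ≤ a.val then a.val - b.val else N + a.val - b.val := by
  split_ifs with h
  · exact ZMod.val_sub h
  · have hba : (b - a).val = b.val - a.val := ZMod.val_sub (by omega)
    have : NeZero (b - a) := ⟨fun h0 => by rw [h0, ZMod.val_zero] at hba; omega⟩
    have hb := b.val_lt
    rw [← neg_sub, ZMod.val_neg_of_ne_zero, hba]
    omega

theorem strictlyInsideArc_iff [NeZero N] {τ : Equiv.Perm (ZMod N)} {a c : ZMod N}
    (ha : a.val < (τ a).val) :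
    StrictlyInsideArc τ a c ↔ a.val < c.val ∧ c.val < (τ a).val := by
  have h := (τ a).val_lt
  rw [StrictlyInsideArc, val_sub_eq_ite, val_sub_eq_ite]
  split_ifs <;> omega

theorem strictlyInsideArc_apply_iff [NeZero N] {τ : Equiv.Perm (ZMod N)}
    (hinv : Function.Involutive τ) {a c : ZMod N} (hfp : τ a ≠ a) (h₁ : c ≠ a) (h₂ : c ≠ τ a) :
    StrictlyInsideArc τ (τ a) c ↔ ¬ StrictlyInsideArc τ a c := by
  have ha := a.val_lt
  have hta := (τ a).val_lt
  have hc := c.val_lt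
  rw [← (ZMod.val_injective N).ne_iff] at hfp h₁ h₂
  simp only [StrictlyInsideArc, hinv a, val_sub_eq_ite]
  split_ifs <;> omega

theorem linkedAt_iff {τ : Equiv.Perm (ZMod N)} {a b : ZMod N} :
    LinkedAt τ a b ↔ b ≠ a ∧ b ≠ τ a ∧ τ b ≠ a ∧ τ b ≠ τ a ∧
      ¬ (StrictlyInsideArc τ a b ↔ StrictlyInsideArc τ a (τ b)) := by
  rw [← xor_iff_not_iff]
  rfl

/-- The indicator function of the points `i` with `b ≤ i < τ b`, for the order of the
representatives in `0, …, N - 1`. -/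
def arcIndicator (τ : Equiv.Perm (ZMod N)) (b i : ZMod N) : ZMod 2 :=
  if b.val ≤ i.val ∧ i.val < (τ b).val then 1 else 0

theorem arcIndicator_sub_one [NeZero N] (hN : 1 < N) {τ : Equiv.Perm (ZMod N)}
    (b j : ZMod N) :
    arcIndicator τ b (j - 1) = if b.val < j.val ∧ j.val ≤ (τ b).val then 1 else 0 := by
  have h := (τ b).val_lt
  rw [arcIndicator]
  by_cases hj : j = 0
  · subst hj
    rw [val_zero_sub_one, ZMod.val_zero]
    congr 1
    apply propext
    omega
  · have h0 : j.val ≠ 0 := (ZMod.val_ne_zero j).2 hj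
    rw [val_sub_one_of_ne_zero hN hj]
    congr 1
    apply propext
    omega

theorem arcIndicator_jump [NeZero N] (hN : 1 < N) {τ : Equiv.Perm (ZMod N)}
    {b : ZMod N} (hb : b.val < (τ b).val) (j : ZMod N) :
    arcIndicator τ b j = arcIndicator τ b (j - 1) + if j = b ∨ j = τ b then 1 else 0 := by
  rw [arcIndicator_sub_one hN, arcIndicator]
  simp only [← (ZMod.val_injective N).eq_iff]
  split_ifs <;> first | rfl | (exfalso; omega)

theorem arcIndicator_surgery [NeZero N] (hN : 1 < N) {τ : Equiv.Perm (ZMod N)}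
    (hinv : Function.Involutive τ) {a b : ZMod N} (ha : a.val < (τ a).val)
    (hb : b.val < (τ b).val) :
    arcIndicator τ b (τ a) = arcIndicator τ b (a - 1) + interMatrix τ a b := by
  have h₁ : b.val = a.val ↔ (τ b).val = (τ a).val := by
    simp only [(ZMod.val_injective N).eq_iff, τ.injective.eq_iff]
  have h₂ : b.val = (τ a).val ↔ (τ b).val = a.val := by
    simp only [(ZMod.val_injective N).eq_iff, hinv.eq_iff]
  rw [arcIndicator_sub_one hN, arcIndicator, interMatrix, Matrix.of_apply]
  simp only [linkedAt_iff, strictlyInsideArc_iff ha, ne_eq,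
    ← (ZMod.val_injective N).eq_iff]
  split_ifs <;> first | rfl | (exfalso; omega)

theorem interMatrix_apply_left [NeZero N] {τ : Equiv.Perm (ZMod N)}
    (hinv : Function.Involutive τ) (hfp : ∀ i, τ i ≠ i) (a b : ZMod N) :
    interMatrix τ (τ a) b = interMatrix τ a b := by
  have h : LinkedAt τ (τ a) b ↔ LinkedAt τ a b := by
    simp only [linkedAt_iff, hinv a]
    constructor
    · rintro ⟨h₁, h₂, h₃, h₄, h⟩
      rw [strictlyInsideArc_apply_iff hinv (hfp a) h₂ h₁, strictlyInsideArc_apply_iff hinv (hfp a) h₄ h₃,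
        not_iff_not] at h
      exact ⟨h₂, h₁, h₄, h₃, h⟩
    · rintro ⟨h₁, h₂, h₃, h₄, h⟩
      rw [strictlyInsideArc_apply_iff hinv (hfp a) h₁ h₂, strictlyInsideArc_apply_iff hinv (hfp a) h₃ h₄,
        not_iff_not]
      exact ⟨h₂, h₁, h₄, h₃, h⟩
  rw [interMatrix, Matrix.of_apply, Matrix.of_apply]
  congr 1
  exact propext h

theorem interMatrix_apply_right {τ : Equiv.Perm (ZMod N)}
    (hinv : Function.Involutive τ) (a b : ZMod N) :
    interMatrix τ a (τ b) = interMatrix τ a b := by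
  have h : LinkedAt τ a (τ b) ↔ LinkedAt τ a b := by
    simp only [linkedAt_iff, hinv b]
    tauto
  rw [interMatrix, Matrix.of_apply, Matrix.of_apply]
  congr 1
  exact propext h

/-- The points of `I` that come first on their chord, one for each chord. -/
abbrev FirstEnds (τ : Equiv.Perm (ZMod N)) (I : Finset (ZMod N)) : Type :=
  {i : ZMod N // i ∈ I ∧ i.val < (τ i).val}

section Chords

variable {τ : Equiv.Perm (ZMod N)} {I : Finset (ZMod N)}

theorem exists_firstEnds (hinv : Function.Involutive τ) (hfp : ∀ i, τ i ≠ i)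
    (hI : ∀ i ∈ I, τ i ∈ I) [NeZero N] {j : ZMod N} (hj : j ∈ I) :
    ∃ r : FirstEnds τ I, j = r ∨ j = τ r := by
  rcases lt_trichotomy j.val (τ j).val with h | h | h
  · exact ⟨⟨j, hj, h⟩, Or.inl rfl⟩
  · exact absurd (ZMod.val_injective N h).symm (hfp j)
  · exact ⟨⟨τ j, hI j hj, by rwa [hinv j]⟩, Or.inr (hinv j).symm⟩

theorem eq_or_eq_apply_iff (hinv : Function.Involutive τ) (r b : FirstEnds τ I) :
    ((r : ZMod N) = b ∨ (r : ZMod N) = τ b) ↔ r = b := by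
  refine ⟨fun h => h.elim Subtype.ext fun h => ?_, fun h => Or.inl (congrArg _ h)⟩
  have h₁ := r.2.2
  have h₂ := b.2.2
  rw [h, hinv] at h₁
  omega

theorem card_firstEnds (hinv : Function.Involutive τ) (hfp : ∀ i, τ i ≠ i)
    (hI : ∀ i ∈ I, τ i ∈ I) [NeZero N] :
    I.card = 2 * Fintype.card (FirstEnds τ I) := by
  have h₁ : Fintype.card (FirstEnds τ I) = (I.filter fun i => i.val < (τ i).val).card :=
    Fintype.card_of_subtype _ (by simp)
  have h₂ : (I.filter fun i => ¬ i.val < (τ i).val).card =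
      (I.filter fun i => i.val < (τ i).val).card := by
    refine Finset.card_bij' (fun i _ => τ i) (fun i _ => τ i) ?_ ?_
      (fun i _ => hinv i) (fun i _ => hinv i)
    · intro i hi
      rw [Finset.mem_filter] at hi ⊢
      have := (ZMod.val_injective N).ne (hfp i)
      exact ⟨hI i hi.1, by rw [hinv i]; omega⟩
    · intro i hi
      rw [Finset.mem_filter] at hi ⊢
      exact ⟨hI i hi.1, by rw [hinv i]; omega⟩
  rw [← Finset.card_filter_add_card_filter_not (p := fun i => i.val < (τ i).val), h₂, h₁]
  ring

/-- The interlacement matrix with one row and one column for each chord of `I`. -/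
noncomputable def chordMatrix (τ : Equiv.Perm (ZMod N)) (I : Finset (ZMod N)) :
    Matrix (FirstEnds τ I) (FirstEnds τ I) (ZMod 2) :=
  (interMatrix τ).submatrix Subtype.val Subtype.val

theorem rank_submatrix_eq_rank_chordMatrix (hinv : Function.Involutive τ)
    (hfp : ∀ i, τ i ≠ i) (hI : ∀ i ∈ I, τ i ∈ I) [NeZero N] :
    ((interMatrix τ).submatrix (fun i : I => (i : ZMod N)) (fun i : I => (i : ZMod N))).rank =
      (chordMatrix τ I).rank := by
  choose r hr using fun i : I => exists_firstEnds hinv hfp hI i.2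
  apply le_antisymm
  · have h : (interMatrix τ).submatrix (fun i : I => (i : ZMod N)) (fun i : I => (i : ZMod N)) =
        (chordMatrix τ I).submatrix r r := ?_
    · exact h ▸ Matrix.rank_submatrix_le (chordMatrix τ I) r r
    refine Matrix.ext fun i j => ?_
    simp only [chordMatrix, Matrix.submatrix_apply]
    rcases hr i with hi | hi <;> rcases hr j with hj | hj <;> rw [hi, hj] <;>
      simp only [interMatrix_apply_left hinv hfp, interMatrix_apply_right hinv]
  · let s : FirstEnds τ I → I := fun i => ⟨i, i.2.1⟩
    exact Matrix.rank_submatrix_le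
      ((interMatrix τ).submatrix (fun i : I => (i : ZMod N)) (fun i : I => (i : ZMod N))) s s

/-- The function on the circle with value `x.1` at `-1` and jump `x.2 b` at both ends of the
chord through `b`. -/
def integrate (τ : Equiv.Perm (ZMod N)) (I : Finset (ZMod N)) [NeZero N] :
    ZMod 2 × (FirstEnds τ I → ZMod 2) →ₗ[ZMod 2] ZMod N → ZMod 2 where
  toFun x i := x.1 + ∑ b, x.2 b * arcIndicator τ b i
  map_add' x y := by
    funext i
    simp only [Prod.fst_add, Prod.snd_add, Pi.add_apply, add_mul, Finset.sum_add_distrib]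
    ring
  map_smul' c x := by
    funext i
    simp only [Prod.smul_fst, Prod.smul_snd, Pi.smul_apply, smul_eq_mul, mul_add,
      Finset.mul_sum, mul_assoc, RingHom.id_apply]

variable {p : Equiv.Perm (ZMod N)}

theorem mem_invariantFunctions_iff_jumps
    (hp : ∀ i, p i = if i + 1 ∈ I then τ (i + 1) else i + 1) {f : ZMod N → ZMod 2} :
    f ∈ invariantFunctions (ZMod 2) p ↔
      (∀ j ∈ I, f (τ j) = f (j - 1)) ∧ ∀ j ∉ I, f j = f (j - 1) := by
  rw [mem_invariantFunctions]
  constructor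
  · refine fun h => ⟨fun j hj => ?_, fun j hj => ?_⟩ <;>
      simpa [hp, hj] using h (j - 1)
  · rintro ⟨h₁, h₂⟩ i
    rw [hp]
    split_ifs with hi
    · simpa using h₁ _ hi
    · simpa using h₂ _ hi

variable [NeZero N]

theorem integrate_apply (x : ZMod 2 × (FirstEnds τ I → ZMod 2)) (i : ZMod N) :
    integrate τ I x i = x.1 + ∑ b, x.2 b * arcIndicator τ b i := rfl

theorem integrate_neg_one (hN : 1 < N) (x : ZMod 2 × (FirstEnds τ I → ZMod 2)) :
    integrate τ I x (-1) = x.1 := by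
  rw [integrate_apply, Finset.sum_eq_zero, add_zero]
  intro b _
  rw [← zero_sub, arcIndicator_sub_one hN, if_neg (by simp), mul_zero]

theorem integrate_eq_sub_one_add (hN : 1 < N) (x : ZMod 2 × (FirstEnds τ I → ZMod 2))
    (j : ZMod N) :
    integrate τ I x j = integrate τ I x (j - 1) +
      ∑ b : FirstEnds τ I, if j = b ∨ j = τ b then x.2 b else 0 := by
  simp only [integrate_apply, add_assoc, ← Finset.sum_add_distrib]
  congr 1
  refine Finset.sum_congr rfl fun b _ => ?_
  rw [arcIndicator_jump hN b.2.2 j, mul_add, mul_ite, mul_one, mul_zero]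

theorem integrate_jump_of_notMem (hN : 1 < N) (hI : ∀ i ∈ I, τ i ∈ I)
    (x : ZMod 2 × (FirstEnds τ I → ZMod 2)) {j : ZMod N} (hj : j ∉ I) :
    integrate τ I x j = integrate τ I x (j - 1) := by
  rw [integrate_eq_sub_one_add hN, Finset.sum_eq_zero, add_zero]
  intro b _
  refine if_neg ?_
  rintro (rfl | rfl)
  exacts [hj b.2.1, hj (hI _ b.2.1)]

theorem integrate_jump_left (hN : 1 < N) (hinv : Function.Involutive τ)
    (x : ZMod 2 × (FirstEnds τ I → ZMod 2)) (r : FirstEnds τ I) :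
    integrate τ I x r = integrate τ I x (r - 1) + x.2 r := by
  rw [integrate_eq_sub_one_add hN]
  simp only [eq_or_eq_apply_iff hinv, Finset.sum_ite_eq, Finset.mem_univ, if_true]

theorem integrate_jump_right (hN : 1 < N) (hinv : Function.Involutive τ)
    (x : ZMod 2 × (FirstEnds τ I → ZMod 2)) (r : FirstEnds τ I) :
    integrate τ I x (τ r) = integrate τ I x (τ r - 1) + x.2 r := by
  have h (b : FirstEnds τ I) : (τ r = b ∨ τ r = τ b) ↔ r = b := by
    rw [hinv.eq_iff, τ.injective.eq_iff, or_comm]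
    exact eq_or_eq_apply_iff hinv r b
  rw [integrate_eq_sub_one_add hN]
  simp only [h, Finset.sum_ite_eq, Finset.mem_univ, if_true]

theorem integrate_surgery (hN : 1 < N) (hinv : Function.Involutive τ)
    (x : ZMod 2 × (FirstEnds τ I → ZMod 2)) (r : FirstEnds τ I) :
    integrate τ I x (τ r) =
      integrate τ I x (r - 1) + (chordMatrix τ I).mulVec x.2 r := by
  simp only [integrate_apply, add_assoc, Matrix.mulVec, dotProduct, ← Finset.sum_add_distrib]
  congr 1
  refine Finset.sum_congr rfl fun b _ => ?_
  rw [arcIndicator_surgery hN hinv r.2.2 b.2.2, chordMatrix, Matrix.submatrix_apply]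
  ring

theorem eq_of_sub_one {α : Type*} {f : ZMod N → α} (h : ∀ j, f j = f (j - 1)) (j : ZMod N) :
    f j = f (-1) := by
  rw [← ZMod.natCast_zmod_val j]
  induction j.val with
  | zero => rw [Nat.cast_zero, h, zero_sub]
  | succ m ih => rw [h, Nat.cast_succ, add_sub_cancel_right, ih]

theorem integrate_injective (hN : 1 < N) (hinv : Function.Involutive τ) :
    Function.Injective (integrate τ I) := by
  intro x y h
  refine Prod.ext ?_ (funext fun r => ?_)
  · rw [← integrate_neg_one hN x, h, integrate_neg_one hN y]
  · have hx := integrate_jump_left hN hinv x r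
    rw [h, integrate_jump_left hN hinv y r] at hx
    exact (add_left_cancel hx).symm

theorem integrate_mem_invariantFunctions_iff (hN : 1 < N) (hinv : Function.Involutive τ)
    (hfp : ∀ i, τ i ≠ i) (hI : ∀ i ∈ I, τ i ∈ I)
    (hp : ∀ i, p i = if i + 1 ∈ I then τ (i + 1) else i + 1)
    (x : ZMod 2 × (FirstEnds τ I → ZMod 2)) :
    integrate τ I x ∈ invariantFunctions (ZMod 2) p ↔ (chordMatrix τ I).mulVec x.2 = 0 := by
  rw [mem_invariantFunctions_iff_jumps hp]
  constructor
  · rintro ⟨h, -⟩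
    funext r
    have hr := integrate_surgery hN hinv x r
    rwa [h r r.2.1, left_eq_add] at hr
  · refine fun h => ⟨fun j hj => ?_, fun j hj => integrate_jump_of_notMem hN hI x hj⟩
    obtain ⟨r, hr⟩ := exists_firstEnds hinv hfp hI hj
    have hs : integrate τ I x (τ r) = integrate τ I x (r - 1) := by
      rw [integrate_surgery hN hinv, h, Pi.zero_apply, add_zero]
    rcases hr with rfl | rfl
    · exact hs
    · rw [hinv, integrate_jump_left hN hinv, ← hs, integrate_jump_right hN hinv, add_assoc,
        CharTwo.add_self_eq_zero, add_zero]

theorem invariantFunctions_le_range_integrate (hN : 1 < N) (hinv : Function.Involutive τ)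
    (hfp : ∀ i, τ i ≠ i) (hI : ∀ i ∈ I, τ i ∈ I)
    (hp : ∀ i, p i = if i + 1 ∈ I then τ (i + 1) else i + 1) :
    invariantFunctions (ZMod 2) p ≤ LinearMap.range (integrate τ I) := by
  intro f hf
  obtain ⟨h₁, h₂⟩ := (mem_invariantFunctions_iff_jumps hp).1 hf
  let x : ZMod 2 × (FirstEnds τ I → ZMod 2) := (f (-1), fun b => f b - f (b - 1))
  refine ⟨x, ?_⟩
  have hjump (j : ZMod N) : (integrate τ I x - f) j = (integrate τ I x - f) (j - 1) := by
    rw [Pi.sub_apply, Pi.sub_apply]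
    by_cases hj : j ∈ I
    · obtain ⟨r, rfl | rfl⟩ := exists_firstEnds hinv hfp hI hj
      · rw [integrate_jump_left hN hinv]
        ring
      · have h := h₁ _ hj
        rw [hinv] at h
        rw [integrate_jump_right hN hinv, h₁ r r.2.1, ← h]
        simp only [x, CharTwo.sub_eq_add]
        linear_combination CharTwo.add_self_eq_zero (f (r - 1))
    · rw [integrate_jump_of_notMem hN hI x hj, h₂ j hj]
  funext j
  have h := eq_of_sub_one hjump j
  rwa [Pi.sub_apply, Pi.sub_apply, integrate_neg_one hN, sub_self, sub_eq_zero] at h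

theorem map_integrate_ker (hN : 1 < N) (hinv : Function.Involutive τ)
    (hfp : ∀ i, τ i ≠ i) (hI : ∀ i ∈ I, τ i ∈ I)
    (hp : ∀ i, p i = if i + 1 ∈ I then τ (i + 1) else i + 1) :
    (LinearMap.ker ((chordMatrix τ I).mulVecLin ∘ₗ
      LinearMap.snd (ZMod 2) (ZMod 2) (FirstEnds τ I → ZMod 2))).map (integrate τ I) =
      invariantFunctions (ZMod 2) p := by
  have hmem := integrate_mem_invariantFunctions_iff hN hinv hfp hI hp
  ext f
  constructor
  · rintro ⟨x, hx, rfl⟩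
    exact (hmem x).2 hx
  · intro hf
    obtain ⟨x, rfl⟩ := invariantFunctions_le_range_integrate hN hinv hfp hI hp hf
    exact ⟨x, (hmem x).1 hf, rfl⟩

theorem cycleCount_add_rank (hN : 1 < N) (hinv : Function.Involutive τ)
    (hfp : ∀ i, τ i ≠ i) (hI : ∀ i ∈ I, τ i ∈ I)
    (hp : ∀ i, p i = if i + 1 ∈ I then τ (i + 1) else i + 1) :
    cycleCount p + (chordMatrix τ I).rank = 1 + Fintype.card (FirstEnds τ I) := by
  have h := LinearMap.finrank_range_add_finrank_ker ((chordMatrix τ I).mulVecLin ∘ₗ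
    LinearMap.snd (ZMod 2) (ZMod 2) (FirstEnds τ I → ZMod 2))
  rw [LinearMap.range_comp_of_range_eq_top _ (LinearMap.range_eq_top.2 LinearMap.snd_surjective), Module.finrank_prod,
    Module.finrank_self, Module.finrank_fintype_fun_eq_card,
    (Submodule.equivMapOfInjective _ (integrate_injective hN hinv) _).finrank_eq,
    map_integrate_ker hN hinv hfp hI hp, finrank_invariantFunctions] at h
  rw [← h, add_comm, Matrix.rank]

end Chords

end ChordDiagram

/-- **Circuit-Nullity Theorem, partial-surgery version.** Let `τ` be a chord diagram
with `n` chords and let `I` be a `τ`-invariant set of points consisting of the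
endpoints of `k` chords (so `|I| = 2k`). The partial surgery permutation
`p_I i = τ (i+1)` if `i+1 ∈ I`, and `p_I i = i+1` otherwise, has exactly
`1 + k - rank (M(τ)_{I×I})` cycles, where `M(τ)_{I×I}` is the principal submatrix
of the interlacement matrix on rows and columns indexed by `I`. -/
theorem circuit_nullity_partial (n k : ℕ) [NeZero n] (τ : Equiv.Perm (ZMod (2 * n)))
    (hinv : Function.Involutive τ) (hfp : ∀ i, τ i ≠ i)
    (I : Finset (ZMod (2 * n))) (hI : ∀ i ∈ I, τ i ∈ I) (hcard : I.card = 2 * k)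
    (pI : Equiv.Perm (ZMod (2 * n)))
    (hpI : ∀ i, pI i = if i + 1 ∈ I then τ (i + 1) else i + 1) :
    cycleCount pI =
      1 + k - ((interMatrix τ).submatrix
        (fun i : I => (i : ZMod (2 * n))) (fun i : I => (i : ZMod (2 * n)))).rank := by
  have hn : n ≠ 0 := NeZero.ne n
  have h := ChordDiagram.cycleCount_add_rank (by omega) hinv hfp hI hpI
  have hc := ChordDiagram.card_firstEnds hinv hfp hI
  rw [ChordDiagram.rank_submatrix_eq_rank_chordMatrix hinv hfp hI]
  omega
end

section
/- Let n ≥ 1, let τ be a fixed-point-free involution of ZMod (2n) (a chord diagram with n chords), and let I and J be complementary τ-invariant subsets of ZMod (2n) (a partition of the n chords into two classes, with |I| = 2k and |J| = 2(n−k)). Let c_I denote the number of cycles of the partial surgery permutation p_I(i) = (τ(i+1) if i+1 ∈ I, else i+1), and similarly c_J for J. Then c_I + c_J = 2 + n − rank(M(τ)_{I×I}) − rank(M(τ)_{J×J}), where ranks are over ZMod 2; equivalently, the quantity 2n − 3n + c_I + c_J (the Euler characteristic V − E + F of the closed surface built from the checkerboard separation, having 2n vertices, 3n edges, and c_I + c_J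 faces) equals 2 − rank(M(τ)_{I×I}) − rank(M(τ)_{J×J}), so the genus of that surface is (rank(M(τ)_{I×I}) + rank(M(τ)_{J×J}))/2. -/
section CycleSpace

variable {β : Type*} (R : Type*) (p : Equiv.Perm β)

/-- The functions that are constant on the cycles of `p`. -/
def cycleSpace [Semiring R] : Submodule R (β → R) where
  carrier := {f | ∀ i, f (p i) = f i}
  add_mem' hf hg i := by simp [hf i, hg i]
  zero_mem' _ := rfl
  smul_mem' c f hf i := by simp [hf i]

theorem mem_cycleSpace [Semiring R] {f : β → R} :
    f ∈ cycleSpace R p ↔ ∀ i, f (p i) = f i := Iff.rfl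

theorem apply_eq_of_sameCycle {γ : Type*} {f : β → γ} (hf : ∀ i, f (p i) = f i) {x y : β}
    (h : p.SameCycle x y) : f x = f y := by
  obtain ⟨m, rfl⟩ := h
  induction m with
  | zero => simp
  | succ m ih => rw [add_comm, zpow_add, Equiv.Perm.mul_apply, zpow_one, hf, ← ih]
  | pred m ih =>
    rw [ih, ← hf ((p ^ (-(m : ℤ) - 1)) x), ← Equiv.Perm.mul_apply, ← zpow_one_add]
    simp

theorem finrank_cycleSpace [Finite β] [CommRing R] [Nontrivial R] :
    Module.finrank R (cycleSpace R p) = cycleCount p := by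
  classical
  have := Fintype.ofFinite (Quotient (sameCycleSetoid p))
  have hrange : cycleSpace R p =
      LinearMap.range (LinearMap.funLeft R R (Quotient.mk (sameCycleSetoid p))) := by
    ext f
    constructor
    · intro hf
      exact ⟨Quotient.lift f fun x y h => apply_eq_of_sameCycle p hf h, rfl⟩
    · rintro ⟨g, rfl⟩ i
      exact congrArg g (Quotient.sound
        (Equiv.Perm.sameCycle_apply_left.2 (Equiv.Perm.SameCycle.refl p i)))
  rw [hrange, LinearMap.finrank_range_of_inj
    (LinearMap.funLeft_injective_of_surjective R R _ Quotient.mk_surjective),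
    Module.finrank_fintype_fun_eq_card, cycleCount, Nat.card_eq_fintype_card]

end CycleSpace

section CircleSums

variable {N : ℕ} [NeZero N] {G : Type*} [AddCommGroup G]

theorem ZMod.val_add_one_cases (i : ZMod N) :
    (i.val + 1 < N ∧ (i + 1).val = i.val + 1) ∨ (i.val + 1 = N ∧ i + 1 = 0) := by
  have hcast : ((i.val + 1 : ℕ) : ZMod N) = i + 1 := by simp
  rcases (Nat.succ_le_of_lt i.val_lt).lt_or_eq with h | h
  · exact .inl ⟨h, by rw [← hcast, ZMod.val_natCast_of_lt h]⟩
  · refine .inr ⟨h, ?_⟩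
    rw [← hcast, show i.val + 1 = N from h, ZMod.natCast_self]

theorem ZMod.sum_eq_sum_range (g : ZMod N → G) :
    ∑ i, g i = ∑ r ∈ Finset.range N, g r := by
  refine Finset.sum_bij' (fun i _ => i.val) (fun r _ => (r : ZMod N)) ?_ ?_ ?_ ?_ ?_
  · intro i _; simpa using i.val_lt
  · intro r _; simp
  · intro i _; simp
  · intro r hr; exact ZMod.val_natCast_of_lt (by simpa using hr)
  · intro i _; simp

/-- A function on the cycle `ZMod N` with total sum zero is a discrete derivative. -/
theorem ZMod.exists_sub_eq_of_sum_eq_zero (g : ZMod N → G) (hg : ∑ i, g i = 0) :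
    ∃ f : ZMod N → G, ∀ i, f i - f (i - 1) = g i := by
  let P : ℕ → G := fun t => ∑ r ∈ Finset.range t, g ((r : ZMod N) + 1)
  have hP : P N = 0 := by
    rw [← hg, ← Equiv.sum_comp (Equiv.addRight (1 : ZMod N)) g, ZMod.sum_eq_sum_range]
    rfl
  have hsucc (i : ZMod N) : P (i.val + 1) = P i.val + g (i + 1) := by
    simp [P, Finset.sum_range_succ]
  refine ⟨fun i => P i.val, fun j => ?_⟩
  obtain ⟨i, rfl⟩ : ∃ i, j = i + 1 := ⟨j - 1, by ring⟩
  have h := hsucc i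
  rcases ZMod.val_add_one_cases i with ⟨-, hv⟩ | ⟨hN, h0⟩
  · simp [hv, h]
  · rw [hN, hP] at h
    have hz : P (i + 1).val = 0 := by simp [h0, P]
    simp only [add_sub_cancel_right, hz, zero_sub]
    exact neg_eq_of_add_eq_zero_right h.symm

open Classical in
/-- Summing a discrete derivative over the points strictly inside an arc. -/
theorem sum_strictlyInsideArc_sub (τ : Equiv.Perm (ZMod N)) (f : ZMod N → G) {a : ZMod N}
    (ha : τ a ≠ a) :
    (∑ b, if StrictlyInsideArc τ a b then f b - f (b - 1) else 0) = f (τ a - 1) - f a := by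
  obtain ⟨t, ht⟩ : ∃ t, (τ a - a).val = t + 1 :=
    Nat.exists_eq_succ_of_ne_zero (by simpa [sub_eq_zero] using ha)
  have htN : t + 1 < N := ht ▸ (τ a - a).val_lt
  have hτ : τ a - 1 = a + t := by
    have : τ a - a = ((t + 1 : ℕ) : ZMod N) := by rw [← ht]; simp
    push_cast at this
    linear_combination this
  rw [← Equiv.sum_comp (Equiv.addLeft a), ZMod.sum_eq_sum_range]
  have hsub : Finset.range N = Finset.range (t + 1) ∪ Finset.Ico (t + 1) N := by
    ext; simp; omega
  rw [hsub, Finset.sum_union (by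
    rw [Finset.disjoint_left]; intro x; simp; omega), Finset.sum_range_succ',
    Finset.sum_eq_zero (s := Finset.Ico (t + 1) N), add_zero]
  · rw [hτ]
    have : ∀ r ∈ Finset.range t, (if StrictlyInsideArc τ a (Equiv.addLeft a ((r + 1 : ℕ) : ZMod N))
        then f (Equiv.addLeft a ((r + 1 : ℕ) : ZMod N)) -
          f (Equiv.addLeft a ((r + 1 : ℕ) : ZMod N) - 1) else 0) =
        f (a + ((r + 1 : ℕ) : ZMod N)) - f (a + (r : ZMod N)) := by
      intro r hr
      rw [Finset.mem_range] at hr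
      have hin : StrictlyInsideArc τ a (Equiv.addLeft a ((r + 1 : ℕ) : ZMod N)) := by
        rw [StrictlyInsideArc, Equiv.coe_addLeft, add_sub_cancel_left,
          ZMod.val_natCast_of_lt (by omega), ht]
        omega
      rw [if_pos hin, Equiv.coe_addLeft]
      congr 2
      push_cast
      ring
    rw [Finset.sum_congr rfl this, Finset.sum_range_sub (fun r : ℕ => f (a + (r : ZMod N)))]
    simp [StrictlyInsideArc]
  · intro r hr
    rw [Finset.mem_Ico] at hr
    refine if_neg ?_
    rw [StrictlyInsideArc, Equiv.coe_addLeft, add_sub_cancel_left,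
      ZMod.val_natCast_of_lt hr.2, ht]
    omega

end CircleSums

section Interlacement

variable {N : ℕ} (τ : Equiv.Perm (ZMod N))

theorem not_strictlyInsideArc_self (a : ZMod N) : ¬ StrictlyInsideArc τ a a := by
  simp [StrictlyInsideArc]

theorem not_strictlyInsideArc_apply (a : ZMod N) : ¬ StrictlyInsideArc τ a (τ a) := by
  simp [StrictlyInsideArc]

open Classical in
theorem interMatrix_apply_eq_add (hinv : Function.Involutive τ) (a b : ZMod N) :
    interMatrix τ a b = (if StrictlyInsideArc τ a b then (1 : ZMod 2) else 0) +
      (if StrictlyInsideArc τ a (τ b) then (1 : ZMod 2) else 0) := by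
  have h₁ := not_strictlyInsideArc_self τ a
  have h₂ := not_strictlyInsideArc_apply τ a
  rw [interMatrix, Matrix.of_apply]
  by_cases hab : b = a
  · simp [LinkedAt, hab, h₁, h₂]
  by_cases hab' : b = τ a
  · simp [LinkedAt, hab', hinv a, h₁, h₂]
  have h₃ : τ b ≠ a := fun h => hab' (by rw [← h, hinv b])
  have h₄ : τ b ≠ τ a := fun h => hab (τ.injective h)
  have h₅ : (1 + 1 : ZMod 2) = 0 := rfl
  by_cases hb : StrictlyInsideArc τ a b <;> by_cases hb' : StrictlyInsideArc τ a (τ b) <;>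
    simp [LinkedAt, hab, hab', h₃, h₄, hb, hb', Xor', h₅]

end Interlacement

section Symmetrization

variable {α : Type*} (σ : α → α)

/-- The endomorphism `y ↦ y + y ∘ σ`. -/
def symmetrize : (α → ZMod 2) →ₗ[ZMod 2] (α → ZMod 2) :=
  LinearMap.id + LinearMap.funLeft (ZMod 2) (ZMod 2) σ

theorem symmetrize_apply (y : α → ZMod 2) (i : α) : symmetrize σ y i = y i + y (σ i) := rfl

theorem mem_ker_symmetrize {y : α → ZMod 2} :
    y ∈ LinearMap.ker (symmetrize σ) ↔ ∀ i, y (σ i) = y i := by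
  simp only [LinearMap.mem_ker, funext_iff, symmetrize_apply, Pi.zero_apply,
    CharTwo.add_eq_zero]
  exact forall_congr' fun i => eq_comm

variable {σ}

theorem range_symmetrize [LinearOrder α] (hσ : Function.Involutive σ) (hfp : ∀ i, σ i ≠ i) :
    LinearMap.range (symmetrize σ) = LinearMap.ker (symmetrize σ) := by
  ext s
  rw [mem_ker_symmetrize]
  constructor
  · rintro ⟨y, rfl⟩ i
    simp [symmetrize_apply, hσ i, add_comm]
  · intro hs
    refine ⟨fun i => if i < σ i then s i else 0, funext fun i => ?_⟩
    rw [symmetrize_apply]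
    rcases (hfp i).lt_or_gt with h | h
    · simp [hσ i, h, h.le, hs]
    · simp [hσ i, h, h.le]

theorem two_mul_finrank_range_symmetrize [Fintype α] [LinearOrder α]
    (hσ : Function.Involutive σ) (hfp : ∀ i, σ i ≠ i) :
    2 * Module.finrank (ZMod 2) (LinearMap.range (symmetrize σ)) = Fintype.card α := by
  have h := LinearMap.finrank_range_add_finrank_ker (symmetrize σ)
  rw [← range_symmetrize hσ hfp, Module.finrank_fintype_fun_eq_card] at h
  omega

end Symmetrization

section Surgery

variable {N : ℕ} (τ : Equiv.Perm (ZMod N)) (I : Finset (ZMod N))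

open Classical in
/-- The sums of a function on `I` over the points of `I` strictly inside each arc. -/
noncomputable def arcSum : (I → ZMod 2) →ₗ[ZMod 2] (I → ZMod 2) :=
  Matrix.mulVecLin (Matrix.of fun a b : I => if StrictlyInsideArc τ a b then 1 else 0)

open Classical in
theorem arcSum_apply (s : I → ZMod 2) (a : I) :
    arcSum τ I s a = ∑ b : I, if StrictlyInsideArc τ a b then s b else 0 := by
  simp [arcSum, Matrix.mulVec, dotProduct, ite_mul]

/-- The discrete derivative of a function on the circle, restricted to `I`. -/
def jump : (ZMod N → ZMod 2) →ₗ[ZMod 2] (I → ZMod 2) :=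
  LinearMap.funLeft (ZMod 2) (ZMod 2) (fun i : I => (i : ZMod N)) -
    LinearMap.funLeft (ZMod 2) (ZMod 2) (fun i : I => (i : ZMod N) - 1)

theorem jump_apply (f : ZMod N → ZMod 2) (i : I) : jump I f i = f i - f (i - 1) := rfl

variable {τ I}

/-- The restriction of `τ` to an invariant set of points. -/
def chordMap (hI : ∀ i ∈ I, τ i ∈ I) (i : I) : I := ⟨τ i, hI i i.2⟩

theorem chordMap_involutive (hinv : Function.Involutive τ) (hI : ∀ i ∈ I, τ i ∈ I) :
    Function.Involutive (chordMap hI) := fun i => Subtype.ext (hinv i)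

theorem chordMap_ne (hfp : ∀ i, τ i ≠ i) (hI : ∀ i ∈ I, τ i ∈ I) (i : I) :
    chordMap hI i ≠ i := fun h => hfp i (congrArg Subtype.val h)

theorem mulVecLin_interMatrix_eq_comp (hinv : Function.Involutive τ)
    (hI : ∀ i ∈ I, τ i ∈ I) :
    ((interMatrix τ).submatrix (fun i : I => (i : ZMod N)) (fun i : I => (i : ZMod N))).mulVecLin =
      arcSum τ I ∘ₗ symmetrize (chordMap hI) := by
  classical
  refine LinearMap.ext fun y => funext fun a => ?_
  have h := Equiv.sum_comp (chordMap_involutive hinv hI).toPerm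
    (fun b : I => if StrictlyInsideArc τ a b then y (chordMap hI b) else 0)
  simp only [Function.Involutive.coe_toPerm, chordMap_involutive hinv hI _] at h
  simp only [LinearMap.comp_apply, arcSum_apply, symmetrize_apply, ite_add_zero,
    Finset.sum_add_distrib]
  rw [← h, ← Finset.sum_add_distrib]
  simp only [Matrix.mulVecLin_apply, Matrix.mulVec, dotProduct, Matrix.submatrix_apply,
    interMatrix_apply_eq_add τ hinv, add_mul, ite_mul, one_mul, zero_mul]
  rfl

theorem arcSum_jump [NeZero N] (hfp : ∀ i, τ i ≠ i) {f : ZMod N → ZMod 2}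
    (hf : ∀ i ∉ I, f i - f (i - 1) = 0) (a : I) :
    arcSum τ I (jump I f) a = f (τ a - 1) - f a := by
  classical
  rw [arcSum_apply, ← sum_strictlyInsideArc_sub τ f (hfp a)]
  simp only [jump_apply]
  rw [Finset.sum_coe_sort I
    (fun b => if StrictlyInsideArc τ a b then f b - f (b - 1) else 0)]
  exact Finset.sum_subset (Finset.subset_univ I) fun b _ hb => by rw [hf b hb, ite_self]

variable {p : Equiv.Perm (ZMod N)}

theorem mem_cycleSpace_surgery_iff (hp : ∀ i, p i = if i + 1 ∈ I then τ (i + 1) else i + 1)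
    {f : ZMod N → ZMod 2} :
    f ∈ cycleSpace (ZMod 2) p ↔
      (∀ i ∈ I, f (τ i) = f (i - 1)) ∧ ∀ i ∉ I, f i - f (i - 1) = 0 := by
  rw [mem_cycleSpace, ← (Equiv.subRight (1 : ZMod N)).forall_congr_right]
  simp only [Equiv.subRight_apply, hp, sub_add_cancel]
  constructor
  · intro h
    exact ⟨fun i hi => by simpa [hi] using h i, fun i hi => by simpa [hi, sub_eq_zero] using h i⟩
  · rintro ⟨h₁, h₂⟩ i
    by_cases hi : i ∈ I
    · simpa [hi] using h₁ i hi
    · simpa [hi, sub_eq_zero] using h₂ i hi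

theorem map_jump_cycleSpace [NeZero N] (hinv : Function.Involutive τ) (hfp : ∀ i, τ i ≠ i)
    (hI : ∀ i ∈ I, τ i ∈ I) (hp : ∀ i, p i = if i + 1 ∈ I then τ (i + 1) else i + 1) :
    (cycleSpace (ZMod 2) p).map (jump I) =
      LinearMap.ker (symmetrize (chordMap hI)) ⊓ LinearMap.ker (arcSum τ I) := by
  classical
  ext s
  rw [Submodule.mem_inf, mem_ker_symmetrize, LinearMap.mem_ker, Submodule.mem_map]
  constructor
  · rintro ⟨f, hf, rfl⟩
    obtain ⟨hf₁, hf₂⟩ := (mem_cycleSpace_surgery_iff hp).1 hf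
    have hf₃ (i : I) : f (τ i - 1) = f i := by rw [← hf₁ _ (hI i i.2), hinv]
    refine ⟨fun i => ?_, funext fun a => ?_⟩
    · rw [jump_apply, jump_apply]
      change f (τ i) - f (τ i - 1) = _
      rw [hf₁ i i.2, hf₃ i, CharTwo.sub_eq_add (f _), CharTwo.sub_eq_add (f _), add_comm]
    · rw [arcSum_jump hfp hf₂, hf₃ a, sub_self, Pi.zero_apply]
  · rintro ⟨hs, hB⟩
    let g : ZMod N → ZMod 2 := fun b => if h : b ∈ I then s ⟨b, h⟩ else 0
    have hgI (i : I) : g i = s i := by simp [g]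
    have hg0 : ∀ i ∉ I, g i = 0 := fun i hi => by simp [g, hi]
    have hτ (i : I) : g (τ i) = g i := by
      rw [hgI, ← hs i, ← hgI]
      rfl
    have hsum : ∑ i, g i = 0 := by
      rw [← Finset.sum_subset (Finset.subset_univ I) fun i _ hi => hg0 i hi]
      refine Finset.sum_involution (fun i _ => τ i) ?_ (fun i _ _ => hfp i) hI
        (fun i _ => hinv i)
      intro i hi
      rw [hτ ⟨i, hi⟩, CharTwo.add_self_eq_zero]
    obtain ⟨f, hf⟩ := ZMod.exists_sub_eq_of_sum_eq_zero g hsum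
    have hfs : jump I f = s := funext fun i => by rw [jump_apply, hf, hgI]
    have hf₂ : ∀ i ∉ I, f i - f (i - 1) = 0 := fun i hi => by rw [hf, hg0 i hi]
    refine ⟨f, (mem_cycleSpace_surgery_iff hp).2 ⟨fun i hi => ?_, hf₂⟩, hfs⟩
    have h₁ := arcSum_jump hfp hf₂ ⟨i, hi⟩
    rw [hfs, hB, Pi.zero_apply] at h₁
    have h₂ : f (τ i) - f (τ i - 1) = f i - f (i - 1) := by
      rw [hf, hf, hτ ⟨i, hi⟩]
    rw [sub_eq_zero.1 h₁.symm, CharTwo.sub_eq_add (f _), CharTwo.sub_eq_add (f _),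
      add_comm (f i)] at h₂
    exact add_right_cancel h₂

theorem finrank_ker_jump_domRestrict_cycleSpace [NeZero N]
    (hp : ∀ i, p i = if i + 1 ∈ I then τ (i + 1) else i + 1) :
    Module.finrank (ZMod 2)
      (LinearMap.ker ((jump I).domRestrict (cycleSpace (ZMod 2) p))) = 1 := by
  refine finrank_eq_one_iff'.2 ⟨⟨⟨fun _ => 1, fun _ => rfl⟩, ?_⟩, ?_, ?_⟩
  · ext i
    exact sub_self _
  · intro h
    exact one_ne_zero (congrFun (congrArg (fun w => w.1.1) h) (0 : ZMod N))
  · rintro ⟨⟨f, hf⟩, hk⟩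
    have hstep (i : ZMod N) : f i = f (i - 1) := by
      by_cases hi : i ∈ I
      · exact sub_eq_zero.1 (congrFun hk ⟨i, hi⟩)
      · exact sub_eq_zero.1 (((mem_cycleSpace_surgery_iff hp).1 hf).2 i hi)
    have hconst (t : ℕ) : f t = f 0 := by
      induction t with
      | zero => simp
      | succ t ih => rw [hstep, ← ih]; simp
    refine ⟨f 0, ?_⟩
    ext i
    have := hconst i.val
    rw [ZMod.natCast_zmod_val] at this
    simp [this]

/-- **Cohn–Lempel formula**: the number of circles obtained by surgery along the chords
with endpoints in `I` is one more than the corank of their interlacement matrix. -/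
theorem two_mul_cycleCount_add_rank_interMatrix [NeZero N] (hinv : Function.Involutive τ) (hfp : ∀ i, τ i ≠ i)
    (hI : ∀ i ∈ I, τ i ∈ I) (hp : ∀ i, p i = if i + 1 ∈ I then τ (i + 1) else i + 1) :
    2 * (cycleCount p + ((interMatrix τ).submatrix
      (fun i : I => (i : ZMod N)) (fun i : I => (i : ZMod N))).rank) = I.card + 2 := by
  classical
  let : LinearOrder I := LinearOrder.lift' (fun i : I => (i : ZMod N).val)
    ((ZMod.val_injective N).comp Subtype.val_injective)
  have hσ := chordMap_involutive hinv hI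
  have hne := chordMap_ne hfp hI
  have hcard := two_mul_finrank_range_symmetrize hσ hne
  rw [range_symmetrize hσ hne, Fintype.card_coe] at hcard
  have hcycles := LinearMap.finrank_range_add_finrank_ker
    ((jump I).domRestrict (cycleSpace (ZMod 2) p))
  rw [finrank_ker_jump_domRestrict_cycleSpace hp, finrank_cycleSpace, LinearMap.range_domRestrict,
    map_jump_cycleSpace hinv hfp hI hp] at hcycles
  have hrank := LinearMap.finrank_range_add_finrank_ker
    ((arcSum τ I).domRestrict (LinearMap.ker (symmetrize (chordMap hI))))
  rw [LinearMap.range_domRestrict, LinearMap.ker_domRestrict,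
    (Submodule.equivSubtypeMap _ _).finrank_eq, Submodule.map_comap_subtype] at hrank
  rw [Matrix.rank, mulVecLin_interMatrix_eq_comp hinv hI, LinearMap.range_comp,
    range_symmetrize hσ hne]
  omega

end Surgery

/-- **Genus of a checkerboard separation.** Let `τ` be a chord diagram with `n`
chords, and let the chords be separated into a white class (endpoints `I`, carrying
`k` chords) and a black class (endpoints `Iᶜ`). Let `c_I` and `c_J` be the numbers of
cycles of the corresponding partial surgery permutations (the white and black faces
of the checkerboard-embedded surface). Then
`c_I + c_J = 2 + n - rank M(τ)_{I×I} - rank M(τ)_{J×J}`,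
so the Euler characteristic `2n - 3n + c_I + c_J` of the resulting closed surface is
`2 - rank M(τ)_{I×I} - rank M(τ)_{J×J}` and its genus is
`(rank M(τ)_{I×I} + rank M(τ)_{J×J}) / 2`. -/
theorem faces_of_separation (n k : ℕ) [NeZero n] (τ : Equiv.Perm (ZMod (2 * n)))
    (hinv : Function.Involutive τ) (hfp : ∀ i, τ i ≠ i)
    (I : Finset (ZMod (2 * n))) (hI : ∀ i ∈ I, τ i ∈ I) (hcard : I.card = 2 * k)
    (pI pJ : Equiv.Perm (ZMod (2 * n)))
    (hpI : ∀ i, pI i = if i + 1 ∈ I then τ (i + 1) else i + 1)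
    (hpJ : ∀ i, pJ i = if i + 1 ∈ Iᶜ then τ (i + 1) else i + 1) :
    cycleCount pI + cycleCount pJ =
      2 + n
        - ((interMatrix τ).submatrix
            (fun i : I => (i : ZMod (2 * n))) (fun i : I => (i : ZMod (2 * n)))).rank
        - ((interMatrix τ).submatrix
            (fun i : (Iᶜ : Finset (ZMod (2 * n))) => (i : ZMod (2 * n)))
            (fun i : (Iᶜ : Finset (ZMod (2 * n))) => (i : ZMod (2 * n)))).rank := by
  have hJ : ∀ i ∈ Iᶜ, τ i ∈ Iᶜ := fun i hi => by
    rw [Finset.mem_compl] at hi ⊢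
    exact fun h => hi (hinv i ▸ hI _ h)
  have h₁ := two_mul_cycleCount_add_rank_interMatrix hinv hfp hI hpI
  have h₂ := two_mul_cycleCount_add_rank_interMatrix hinv hfp hJ hpJ
  have h₃ := Finset.card_add_card_compl I
  rw [ZMod.card] at h₃
  omega
end

section
/- Let D be a finite nonempty type, let σ and α be permutations of D with α a fixed-point-free involution, such that every orbit of σ has size 4 or 6, the subgroup generated by σ and α acts transitively on D (the graph is connected), and there exists f : D → Bool with f(α d) ≠ f(d) and f(σ d) ≠ f(d) for all d (the source-sink condition holds). Then there exist a subset S ⊆ D such that D is the disjoint union of S and α(S) (a choice of one direction for each edge), and a permutation ρ of S that is a single cycle on all of S (an Euler circuit traversing each edge once), such that for every vertex v (every σ-orbit O): the pairs (α s, ρ s), taken over all s ∈ S with α s ∈ O, partition O into |O|/2 transition pairs, and (i) if |O| = 4, every such pair (a, b) satisfies b = σ(a) or b = σ⁻¹(a) (the vertex is rotating); (ii) if |O| = 6, either every such pair (a, b) satisfies b = σ(a) or b = σ⁻¹(a) (the vertex is rotating), or exactly one pair satisfies b = σ³(a) while each of the other two pairs satisfies b = σ(a) or b = σ⁻¹(a)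 (the vertex is splitting). -/
namespace Equiv.Perm

/-- Multiplying by the transposition of two points in different cycles merges these cycles. -/
theorem sameCycle_swap_mul {X : Type*} [Finite X] [DecidableEq X] {ρ : Perm X} {a b : X}
    (h : ¬ ρ.SameCycle a b) : (swap a b * ρ).SameCycle a b := by
  classical
  have hex : ∃ n, 0 < n ∧ (ρ ^ n) a = a :=
    ⟨orderOf ρ, orderOf_pos ρ, by rw [pow_orderOf_eq_one, one_apply]⟩
  obtain ⟨hpos, hret⟩ := Nat.find_spec hex
  have key : ∀ i, i < Nat.find hex → ((swap a b * ρ) ^ i) a = (ρ ^ i) a := by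
    intro i
    induction i with
    | zero => simp
    | succ i ih =>
      intro hi
      rw [pow_succ', mul_apply, ih (by omega), mul_apply, ← mul_apply ρ, ← pow_succ']
      refine swap_apply_of_ne_of_ne (fun hc => Nat.find_min hex hi ⟨by omega, hc⟩) fun hc => h ?_
      exact ⟨(i + 1 : ℕ), by rw [zpow_natCast, hc]⟩
  refine ⟨(Nat.find hex : ℕ), ?_⟩
  obtain ⟨k, hk⟩ : ∃ k, Nat.find hex = k + 1 := ⟨Nat.find hex - 1, by omega⟩
  rw [hk] at hret key ⊢
  rw [zpow_natCast, pow_succ', mul_apply, key k (by omega), mul_apply, ← mul_apply ρ,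
    ← pow_succ', hret, swap_apply_left]

/-- If a transposition merges two cycles, then it does not separate any other two points. -/
theorem SameCycle.swap_mul {X : Type*} [Finite X] [DecidableEq X] {ρ : Perm X} {a b : X}
    (h : ¬ ρ.SameCycle a b) {x y : X} (hxy : ρ.SameCycle x y) :
    (swap a b * ρ).SameCycle x y := by
  have hab := sameCycle_swap_mul h
  have step : ∀ z, (swap a b * ρ).SameCycle z (ρ z) := by
    intro z
    have hz : (swap a b * ρ).SameCycle z (swap a b (ρ z)) := ⟨1, by simp⟩
    by_cases h1 : ρ z = a
    · rw [h1, swap_apply_left] at hz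
      rw [h1]
      exact hz.trans hab.symm
    by_cases h2 : ρ z = b
    · rw [h2, swap_apply_right] at hz
      rw [h2]
      exact hz.trans hab
    rwa [swap_apply_of_ne_of_ne h1 h2] at hz
  obtain ⟨n, rfl⟩ := hxy.exists_nat_pow_eq
  clear hxy
  induction n with
  | zero => exact SameCycle.refl _ _
  | succ n ih =>
    rw [pow_succ', mul_apply]
    exact ih.trans (step _)

/-- Among the permutations with a given property there is one whose distinct cycles cannot be
merged by a transposition without losing that property. -/
theorem exists_forall_swap_mul_sameCycle {X : Type*} [Finite X] [DecidableEq X]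
    {P : Perm X → Prop} (h : ∃ ρ, P ρ) :
    ∃ ρ, P ρ ∧ ∀ a b, P (swap a b * ρ) → ρ.SameCycle a b := by
  have hfin : {ρ | P ρ}.Finite := Set.toFinite _
  obtain ⟨ρ, hρ, hmax⟩ := Set.exists_max_image {ρ | P ρ}
    (fun ρ => {p : X × X | ρ.SameCycle p.1 p.2}.ncard) hfin h
  refine ⟨ρ, hρ, fun a b hab => ?_⟩
  by_contra hne
  refine (hmax _ hab).not_gt (Set.ncard_lt_ncard ⟨fun p hp => SameCycle.swap_mul hne hp, ?_⟩)
  exact fun hsub => hne (hsub (a := (a, b)) (sameCycle_swap_mul hne))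

theorem pow_apply_eq_pow_apply_iff_modEq_card_support_cycleOf {D : Type*} [Fintype D]
    [DecidableEq D] {σ : Perm D} {d : D} (hd : σ d ≠ d) {m n : ℕ} :
    (σ ^ m) d = (σ ^ n) d ↔ m ≡ n [MOD (σ.cycleOf d).support.card] :=
  (isCycleOn_support_cycleOf σ d).pow_apply_eq_pow_apply
    ((mem_support_cycleOf_iff' hd).2 (SameCycle.refl _ _))

/-- A source-sink colouring alternates along the powers of the rotation. -/
theorem bool_pow_apply_of_alternating {D : Type*} {σ : Perm D} {f : D → Bool}
    (hσ : ∀ d, f (σ d) ≠ f d) (d : D) (n : ℕ) : f ((σ ^ n) d) = f d ↔ Even n := by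
  induction n with
  | zero => simp
  | succ n ih =>
    have h := hσ ((σ ^ n) d)
    rw [pow_succ', mul_apply, Nat.even_add_one, ← ih]
    revert h
    cases f (σ ((σ ^ n) d)) <;> cases f ((σ ^ n) d) <;> cases f d <;> simp

theorem SameCycle.exists_odd_pow_eq {D : Type*} [Fintype D] [DecidableEq D] {σ : Perm D}
    {f : D → Bool} (hσ : ∀ d, f (σ d) ≠ f d) {d e : D} (h : σ.SameCycle d e)
    (hde : f e ≠ f d) : ∃ n < (σ.cycleOf d).support.card, ¬ Even n ∧ (σ ^ n) d = e := by
  obtain ⟨n, hn, rfl⟩ := h.exists_pow_eq_of_mem_support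
    (mem_support.2 fun hc => hσ d (congrArg f hc))
  exact ⟨n, hn, fun hev => hde ((bool_pow_apply_of_alternating hσ d n).2 hev), Eq.refl _⟩

theorem SameCycle.exists_even_pow_eq {D : Type*} [Fintype D] [DecidableEq D] {σ : Perm D}
    {f : D → Bool} (hσ : ∀ d, f (σ d) ≠ f d) {d e : D} (h : σ.SameCycle d e)
    (hde : f e = f d) : ∃ n < (σ.cycleOf d).support.card, Even n ∧ (σ ^ n) d = e := by
  obtain ⟨n, hn, rfl⟩ := h.exists_pow_eq_of_mem_support
    (mem_support.2 fun hc => hσ d (congrArg f hc))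
  exact ⟨n, hn, (bool_pow_apply_of_alternating hσ d n).1 hde, Eq.refl _⟩

/-- The permutations `ρ` that stay at a vertex at each transition and do not join opposite half-edges
at all three visits of a vertex of degree 6. -/
def IsTransitionSystem {D : Type*} [Fintype D] [DecidableEq D] (σ α : Perm D) {S : Finset D}
    (ρ : Perm {x // x ∈ S}) : Prop :=
  (∀ s : {x // x ∈ S}, σ.SameCycle (α (s : D)) (ρ s : D)) ∧
    ∀ v : D, (σ.cycleOf v).support.card = 6 →
      ∃ s : {x // x ∈ S}, σ.SameCycle v (α (s : D)) ∧ (ρ s : D) ≠ (σ ^ 3) (α (s : D))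

/-- Turning each arriving half-edge to its successor gives a transition system. -/
theorem exists_isTransitionSystem {D : Type*} [Fintype D] [DecidableEq D] {σ α : Perm D}
    {f : D → Bool} {S : Finset D} (hS : ∀ d, d ∈ S ↔ f d = true)
    (hinv : Function.Involutive α) (hα : ∀ d, f (α d) ≠ f d) (hσ : ∀ d, f (σ d) ≠ f d) :
    ∃ ρ : Perm {x // x ∈ S}, IsTransitionSystem σ α ρ := by
  have hmem : ∀ s : {x // x ∈ S}, σ (α s) ∈ S := by
    intro s
    have h1 := hα s
    have h2 := hσ (α s)
    rw [(hS s).1 s.2] at h1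
    rw [hS]
    simp_all
  let r : {x // x ∈ S} → {x // x ∈ S} := fun s => ⟨σ (α s), hmem s⟩
  have hr : Function.Injective r := fun s t hst =>
    Subtype.ext (α.injective (σ.injective (congrArg Subtype.val hst)))
  have hsame : ∀ d, σ.SameCycle d (σ d) := fun d => ⟨1, by simp⟩
  refine ⟨Equiv.ofBijective r (Finite.injective_iff_bijective.1 hr), fun s => hsame _, ?_⟩
  intro v hv
  obtain ⟨s, hs⟩ : ∃ s : {x // x ∈ S}, σ.SameCycle v (α s) := by
    by_cases h : f v = true
    · refine ⟨⟨α (σ v), (hS _).2 ?_⟩, by simpa only [hinv _] using hsame v⟩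
      have h1 := hσ v
      have h2 := hα (σ v)
      simp_all
    · refine ⟨⟨α v, (hS _).2 ?_⟩, by simpa only [hinv _] using SameCycle.refl _ _⟩
      have h2 := hα v
      simp_all
  refine ⟨s, hs, fun hc => ?_⟩
  have hc' : (σ ^ 1) (α (s : D)) = (σ ^ 3) (α (s : D)) := hc
  rw [pow_apply_eq_pow_apply_iff_modEq_card_support_cycleOf
    (fun h => hσ _ (congrArg f h)), ← hs.cycleOf_eq, hv] at hc'
  revert hc'
  decide

/-- If transposing two departures at a vertex does not give a transition system, then that vertex
has degree 6 and the transposition makes all its transitions opposite. -/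
theorem IsTransitionSystem.eq_pow_three_of_not_swap_mul {D : Type*} [Fintype D] [DecidableEq D]
    {σ α : Perm D} {S : Finset D} {ρ : Perm {x // x ∈ S}} (hρ : IsTransitionSystem σ α ρ)
    {a b : {x // x ∈ S}} (hab : σ.SameCycle (a : D) b)
    (h : ¬ IsTransitionSystem σ α (swap a b * ρ)) :
    (σ.cycleOf (a : D)).support.card = 6 ∧ ∀ s : {x // x ∈ S}, σ.SameCycle (a : D) (α (s : D)) →
      ((swap a b * ρ) s : D) = (σ ^ 3) (α (s : D)) := by
  have hsame : ∀ s : {x // x ∈ S}, σ.SameCycle (α (s : D)) ((swap a b * ρ) s : D) := by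
    intro s
    have hs := hρ.1 s
    rw [mul_apply]
    by_cases h1 : ρ s = a
    · rw [h1] at hs ⊢
      rw [swap_apply_left]
      exact hs.trans hab
    by_cases h2 : ρ s = b
    · rw [h2] at hs ⊢
      rw [swap_apply_right]
      exact hs.trans hab.symm
    rwa [swap_apply_of_ne_of_ne h1 h2]
  by_contra hne
  refine h ⟨hsame, fun v hv => ?_⟩
  by_cases hva : σ.SameCycle v a
  · by_contra! hall
    exact hne ⟨by rw [← hva.cycleOf_eq, hv], fun s hs => hall s (hva.trans hs)⟩
  · obtain ⟨s, hs, hs'⟩ := hρ.2 v hv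
    refine ⟨s, hs, ?_⟩
    have h1 : ρ s ≠ a := fun hc => hva (hs.trans (hc ▸ hρ.1 s))
    have h2 : ρ s ≠ b := fun hc => hva ((hs.trans (hc ▸ hρ.1 s)).trans hab.symm)
    rwa [mul_apply, swap_apply_of_ne_of_ne h1 h2]

/-- If no transposition can merge two cycles of a transition system, then all departures from a
vertex lie in the same cycle. -/
theorem IsTransitionSystem.sameCycle_of_maximal {D : Type*} [Fintype D] [DecidableEq D]
    {σ α : Perm D} {f : D → Bool} {S : Finset D} (hS : ∀ d, d ∈ S ↔ f d = true)
    (hσ : ∀ d, f (σ d) ≠ f d) {ρ : Perm {x // x ∈ S}} (hρ : IsTransitionSystem σ α ρ)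
    (hmax : ∀ a b, IsTransitionSystem σ α (swap a b * ρ) → ρ.SameCycle a b)
    {a b : {x // x ∈ S}} (hab : σ.SameCycle (a : D) b) : ρ.SameCycle a b := by
  have merge : ∀ {a b c : {x // x ∈ S}}, σ.SameCycle (a : D) b → σ.SameCycle (a : D) c →
      ¬ ρ.SameCycle a b → ¬ ρ.SameCycle a c → b = c := by
    intro a b c hab hac nab nac
    have hs : σ.SameCycle (a : D) (α (ρ.symm a : {x // x ∈ S})) := by
      simpa using (hρ.1 (ρ.symm a)).symm
    have hb := (hρ.eq_pow_three_of_not_swap_mul hab (fun h => nab (hmax _ _ h))).2 _ hs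
    have hc := (hρ.eq_pow_three_of_not_swap_mul hac (fun h => nac (hmax _ _ h))).2 _ hs
    simpa using Subtype.ext (hb.trans hc.symm)
  by_contra nab
  have hcard := (hρ.eq_pow_three_of_not_swap_mul hab (fun h => nab (hmax _ _ h))).1
  have hfa : f a = true := (hS _).1 a.2
  have hfb : f b = true := (hS _).1 b.2
  obtain ⟨c, hac, hca, hcb⟩ : ∃ c : {x // x ∈ S}, σ.SameCycle (a : D) c ∧ c ≠ a ∧ c ≠ b := by
    obtain ⟨n, hn, hev, hnb⟩ := SameCycle.exists_even_pow_eq hσ hab (hfb.trans hfa.symm)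
    have hne : ∀ {k l : ℕ}, ¬ k ≡ l [MOD 6] → (σ ^ k) (a : D) ≠ (σ ^ l) (a : D) := by
      intro k l hkl
      rwa [Ne, pow_apply_eq_pow_apply_iff_modEq_card_support_cycleOf
        (fun h => hσ _ (congrArg f h)), hcard]
    have hmem : ∀ k, Even k → (σ ^ k) (a : D) ∈ S := fun k hk =>
      (hS _).2 (((bool_pow_apply_of_alternating hσ _ k).2 hk).trans hfa)
    have hk : ∃ k, Even k ∧ ¬ k ≡ 0 [MOD 6] ∧ ¬ k ≡ n [MOD 6] := by
      rw [hcard] at hn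
      clear hnb
      interval_cases n
      · exact ⟨2, by decide⟩
      · exact ⟨2, by decide⟩
      · exact ⟨4, by decide⟩
      · exact ⟨2, by decide⟩
      · exact ⟨2, by decide⟩
      · exact ⟨2, by decide⟩
    obtain ⟨k, hke, hk0, hkn⟩ := hk
    refine ⟨⟨(σ ^ k) (a : D), hmem k hke⟩, ⟨k, by simp⟩, fun h => ?_, fun h => ?_⟩
    · exact hne hk0 (by simpa using congrArg Subtype.val h)
    · exact hne hkn (by rw [hnb]; exact congrArg Subtype.val h)
  by_cases nac : ρ.SameCycle a c
  · have nbc : ¬ ρ.SameCycle b c := fun h => nab (nac.trans h.symm)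
    exact hca (merge hab.symm (hab.symm.trans hac) (fun h => nab h.symm) nbc).symm
  · exact hcb (merge hab hac nab nac).symm

/-- In a connected rotation system, a transition system all of whose visits to a common vertex lie
in one cycle is a single cycle. -/
theorem IsTransitionSystem.sameCycle_of_connected {D : Type*} [Fintype D] [DecidableEq D]
    {σ α : Perm D} {f : D → Bool} {S : Finset D} (hS : ∀ d, d ∈ S ↔ f d = true)
    (hinv : Function.Involutive α) (hα : ∀ d, f (α d) ≠ f d) (hσ : ∀ d, f (σ d) ≠ f d)
    (htrans : ∀ x y : D, ∃ g ∈ Subgroup.closure ({σ, α} : Set (Perm D)), g x = y)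
    {ρ : Perm {x // x ∈ S}} (hρ : IsTransitionSystem σ α ρ)
    (hloc : ∀ a b : {x // x ∈ S}, σ.SameCycle (a : D) b → ρ.SameCycle a b)
    (x y : {x // x ∈ S}) : ρ.SameCycle x y := by
  have hsame : ∀ d, σ.SameCycle d (σ d) := fun d => ⟨1, by simp⟩
  have hrep : ∀ d, ∃ s : {x // x ∈ S}, σ.SameCycle d s := by
    intro d
    by_cases h : f d = true
    · exact ⟨⟨d, (hS d).2 h⟩, SameCycle.refl _ _⟩
    · refine ⟨⟨σ d, (hS _).2 ?_⟩, hsame d⟩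
      have := hσ d
      simp_all
  choose r hr using hrep
  have hrα : ∀ d, d ∈ S → ρ.SameCycle (r d) (r (α d)) := by
    intro d hd
    have h1 : ρ.SameCycle (r d) ⟨d, hd⟩ := hloc _ _ (hr d).symm
    have h2 : ρ.SameCycle (ρ ⟨d, hd⟩) (r (α d)) := hloc _ _ ((hρ.1 ⟨d, hd⟩).symm.trans (hr _))
    exact h1.trans (sameCycle_apply_left.1 h2)
  have hstep : ∀ g ∈ Subgroup.closure ({σ, α} : Set (Perm D)), ∀ d,
      ρ.SameCycle (r d) (r (g d)) := by
    intro g hg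
    induction hg using Subgroup.closure_induction with
    | mem g hg =>
      intro d
      rcases hg with rfl | rfl
      · exact hloc _ _ (((hr d).symm.trans (hsame d)).trans (hr _))
      · by_cases hd : d ∈ S
        · exact hrα d hd
        · have hd' : g d ∈ S := by
            have := hα d
            rw [hS] at hd ⊢
            simp_all
          simpa only [hinv d] using (hrα _ hd').symm
    | one => exact fun d => SameCycle.refl _ _
    | mul g h _ _ ihg ihh => exact fun d => (ihh d).trans (ihg (h d))
    | inv g _ ih =>
      intro d
      simpa using (ih (g⁻¹ d)).symm
  obtain ⟨g, hg, hgxy⟩ := htrans x y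
  have h := hstep g hg x
  rw [hgxy] at h
  exact ((hloc _ _ (hr x)).trans h).trans (hloc _ _ (hr y)).symm

/-- A transition system has at most one opposite transition at a vertex of degree 6. -/
theorem IsTransitionSystem.eq_of_eq_pow_three {D : Type*} [Fintype D] [DecidableEq D]
    {σ α : Perm D} {f : D → Bool} {S : Finset D} (hS : ∀ d, d ∈ S ↔ f d = true)
    (hα : ∀ d, f (α d) ≠ f d) (hσ : ∀ d, f (σ d) ≠ f d)
    {ρ : Perm {x // x ∈ S}} (hρ : IsTransitionSystem σ α ρ) {v : D}
    (hv : (σ.cycleOf v).support.card = 6) {s t : {x // x ∈ S}}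
    (hs : σ.SameCycle v (α (s : D))) (ht : σ.SameCycle v (α (t : D)))
    (hs3 : (ρ s : D) = (σ ^ 3) (α (s : D))) (ht3 : (ρ t : D) = (σ ^ 3) (α (t : D))) :
    s = t := by
  by_contra hst
  have hfS : ∀ u : {x // x ∈ S}, f u = true := fun u => (hS u).1 u.2
  have hfα : ∀ u : {x // x ∈ S}, f (α u) = false := by
    intro u
    have := hα u
    rw [hfS u] at this
    simpa using this
  have hinj : ∀ {u w : {x // x ∈ S}}, α (u : D) = α w → u = w := fun h =>
    Subtype.ext (α.injective h)
  have hcard : (σ.cycleOf (α (s : D))).support.card = 6 := by rw [← hs.cycleOf_eq, hv]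
  have hmod : ∀ {k l : ℕ}, k ≡ l [MOD 6] → (σ ^ k) (α (s : D)) = (σ ^ l) (α (s : D)) := by
    intro k l hkl
    rwa [pow_apply_eq_pow_apply_iff_modEq_card_support_cycleOf
      (fun h => hσ _ (congrArg f h)), hcard]
  obtain ⟨k, hk, hke, hkt⟩ := SameCycle.exists_even_pow_eq hσ (hs.symm.trans ht)
    ((hfα t).trans (hfα s).symm)
  obtain ⟨u, hu, hu3⟩ := hρ.2 v hv
  obtain ⟨l, hl, hle, hlu⟩ := SameCycle.exists_even_pow_eq hσ (hs.symm.trans hu)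
    ((hfα u).trans (hfα s).symm)
  obtain ⟨m, hm, hmo, hmu⟩ := SameCycle.exists_odd_pow_eq hσ (hρ.1 u)
    (by rw [hfS, hfα]; simp)
  rw [← hu.cycleOf_eq, hv] at hm
  rw [hcard] at hk hl
  have hus : u ≠ s := fun h => hu3 (h ▸ hs3)
  have hut : u ≠ t := fun h => hu3 (h ▸ ht3)
  have hk0 : k ≠ 0 := by
    rintro rfl
    exact hst (hinj hkt)
  have hl0 : l ≠ 0 := by
    rintro rfl
    exact hus (hinj hlu).symm
  have hkl : k ≠ l := by
    rintro rfl
    exact hut (hinj (hlu.symm.trans hkt))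
  have hm3 : m ≠ 3 := by
    rintro rfl
    exact hu3 hmu.symm
  have hms : ¬ m + l ≡ 3 [MOD 6] := fun h => hus <| ρ.injective <| Subtype.ext <| by
    rw [hs3, ← hmod h, ← hmu, ← hlu, pow_add, mul_apply]
  have hmt : ¬ m + l ≡ 3 + k [MOD 6] := fun h => hut <| ρ.injective <| Subtype.ext <| by
    rw [ht3, ← hkt, ← mul_apply, ← pow_add, ← hmod h, ← hmu, ← hlu, pow_add, mul_apply]
  rw [Nat.ModEq] at hms hmt
  rw [Nat.even_iff] at hke hle hmo
  omega

end Equiv.Perm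

/-- **Existence of rotating-splitting circuits.** Let `(D, σ, α)` be a rotation system:
`D` a finite nonempty set of darts, `σ` a permutation whose orbits are the vertices
(giving the cyclic adjacency order of half-edges, so darts `a`, `b` at a vertex are
adjacent when `b = σ a` or `b = σ⁻¹ a`, and opposite at a degree-6 vertex when
`b = σ³ a`), and `α` a fixed-point-free involution whose orbits are the edges.
Assume every vertex has degree 4 or 6, the system is connected (the subgroup
generated by `σ` and `α` acts transitively on `D`), and the source-sink condition
holds. Then there is an Euler circuit — a set `S` of darts containing exactly one
dart of each edge, together with a single-cycle permutation `ρ` of `S` (traversing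
dart `s`, the circuit arrives at the vertex of `α s` and departs along `ρ s`) — such
that for every vertex `O` (σ-orbit), the transition pairs `(α s, ρ s)` over `s ∈ S`
with `α s ∈ O` partition `O` into `|O|/2` pairs, every degree-4 vertex is rotating,
and every degree-6 vertex is rotating or splitting. -/
theorem exists_rotating_splitting_circuit {D : Type*} [Fintype D] [DecidableEq D]
    [Nonempty D] (σ α : Equiv.Perm D)
    (hinv : Function.Involutive α) (hfp : ∀ d, α d ≠ d)
    (hdeg : ∀ d : D, (σ.cycleOf d).support.card = 4 ∨ (σ.cycleOf d).support.card = 6)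
    (htrans : ∀ x y : D, ∃ g ∈ Subgroup.closure ({σ, α} : Set (Equiv.Perm D)), g x = y)
    (hss : ∃ f : D → Bool, ∀ d, f (α d) ≠ f d ∧ f (σ d) ≠ f d) :
    ∃ (S : Finset D) (ρ : Equiv.Perm {x // x ∈ S}),
      -- `D` is the disjoint union of `S` and `α '' S`: a choice of one dart per edge
      (∀ d : D, d ∈ S ↔ α d ∉ S) ∧
      -- `ρ` is a single cycle on all of `S`: an Euler circuit
      (∀ x y : {x // x ∈ S}, ρ.SameCycle x y) ∧
      -- each transition pair `(α s, ρ s)` lies at a single vertex (a σ-orbit)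
      (∀ s : {x // x ∈ S}, σ.SameCycle (α (s : D)) ((ρ s : D))) ∧
      -- the transition pairs partition each vertex: every dart `d` at a vertex `v`
      -- belongs to exactly one transition pair at `v`
      (∀ v d : D, σ.SameCycle v d →
        ∃! s : {x // x ∈ S}, σ.SameCycle v (α (s : D)) ∧
          (d = α (s : D) ∨ d = (ρ s : D))) ∧
      -- every degree-4 vertex is rotating
      (∀ v : D, (σ.cycleOf v).support.card = 4 →
        ∀ s : {x // x ∈ S}, σ.SameCycle v (α (s : D)) →
          ((ρ s : D) = σ (α (s : D)) ∨ (ρ s : D) = σ⁻¹ (α (s : D)))) ∧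
      -- every degree-6 vertex is rotating or splitting
      (∀ v : D, (σ.cycleOf v).support.card = 6 →
        ((∀ s : {x // x ∈ S}, σ.SameCycle v (α (s : D)) →
            ((ρ s : D) = σ (α (s : D)) ∨ (ρ s : D) = σ⁻¹ (α (s : D)))) ∨
         ((∃! s : {x // x ∈ S}, σ.SameCycle v (α (s : D)) ∧
              (ρ s : D) = (σ ^ 3) (α (s : D))) ∧
          (∀ s : {x // x ∈ S}, σ.SameCycle v (α (s : D)) →
            ((ρ s : D) = (σ ^ 3) (α (s : D)) ∨
             (ρ s : D) = σ (α (s : D)) ∨ (ρ s : D) = σ⁻¹ (α (s : D))))))) := by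
  obtain ⟨f, hf⟩ := hss
  have hα : ∀ d, f (α d) ≠ f d := fun d => (hf d).1
  have hσ : ∀ d, f (σ d) ≠ f d := fun d => (hf d).2
  have hS : ∀ d, d ∈ Finset.univ.filter (fun d => f d = true) ↔ f d = true := by simp
  generalize Finset.univ.filter (fun d => f d = true) = S at hS
  obtain ⟨ρ, hρ, hmax⟩ := Equiv.Perm.exists_forall_swap_mul_sameCycle
    (Equiv.Perm.exists_isTransitionSystem hS hinv hα hσ)
  have hfS : ∀ s : {x // x ∈ S}, f s = true := fun s => (hS s).1 s.2
  have hfα : ∀ s : {x // x ∈ S}, f (α s) = false := by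
    intro s
    have := hα s
    rw [hfS s] at this
    simpa using this
  have hodd : ∀ s : {x // x ∈ S},
      ∃ n < (σ.cycleOf (α (s : D))).support.card, ¬ Even n ∧ (σ ^ n) (α (s : D)) = ρ s :=
    fun s => Equiv.Perm.SameCycle.exists_odd_pow_eq hσ (hρ.1 s) (by rw [hfS, hfα]; simp)
  have hpred : ∀ (s : {x // x ∈ S}) (n : ℕ), (σ.cycleOf (α (s : D))).support.card = n + 1 →
      (σ ^ n) (α (s : D)) = σ⁻¹ (α (s : D)) := by
    intro s n hn
    rw [Equiv.Perm.eq_inv_iff_eq, ← Equiv.Perm.mul_apply, ← pow_succ']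
    exact (Equiv.Perm.pow_apply_eq_pow_apply_iff_modEq_card_support_cycleOf (n := 0)
      (fun h => hσ _ (congrArg f h))).2 (by rw [hn]; simp [Nat.ModEq])
  refine ⟨S, ρ, ?_, ?_, hρ.1, ?_, ?_, ?_⟩
  · intro d
    have := hα d
    rw [hS, hS]
    cases h1 : f d <;> cases h2 : f (α d) <;> simp_all
  · exact hρ.sameCycle_of_connected hS hinv hα hσ htrans
      fun a b => hρ.sameCycle_of_maximal hS hσ hmax
  · intro v d hvd
    cases hd : f d
    · have hmem : α d ∈ S := by
        have := hα d
        rw [hS]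
        simp_all
      refine ⟨⟨α d, hmem⟩, by simpa [hinv d] using hvd, ?_⟩
      rintro t ⟨-, rfl | rfl⟩
      · exact Subtype.ext (hinv _).symm
      · simp [hfS] at hd
    · have hmem : d ∈ S := (hS d).2 hd
      have hsame := hρ.1 (ρ.symm ⟨d, hmem⟩)
      rw [Equiv.apply_symm_apply] at hsame
      refine ⟨ρ.symm ⟨d, hmem⟩, ⟨hvd.trans hsame.symm, by simp⟩, ?_⟩
      rintro t ⟨-, rfl | rfl⟩
      · simp [hfα] at hd
      · simp
  · intro v hv s hs
    obtain ⟨n, hn, hno, hns⟩ := hodd s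
    have hcard : (σ.cycleOf (α (s : D))).support.card = 4 := by rw [← hs.cycleOf_eq, hv]
    rw [hcard] at hn
    rw [← hns]
    obtain rfl | rfl : n = 1 ∨ n = 3 := by rw [Nat.even_iff] at hno; omega
    · exact Or.inl rfl
    · exact Or.inr (hpred s 3 hcard)
  · intro v hv
    have hcases : ∀ s : {x // x ∈ S}, σ.SameCycle v (α (s : D)) →
        ((ρ s : D) = (σ ^ 3) (α (s : D)) ∨
          (ρ s : D) = σ (α (s : D)) ∨ (ρ s : D) = σ⁻¹ (α (s : D))) := by
      intro s hs
      obtain ⟨n, hn, hno, hns⟩ := hodd s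
      have hcard : (σ.cycleOf (α (s : D))).support.card = 6 := by rw [← hs.cycleOf_eq, hv]
      rw [hcard] at hn
      rw [← hns]
      obtain rfl | rfl | rfl : n = 3 ∨ n = 1 ∨ n = 5 := by rw [Nat.even_iff] at hno; omega
      · exact Or.inl rfl
      · exact Or.inr (Or.inl rfl)
      · exact Or.inr (Or.inr (hpred s 5 hcard))
    by_cases h3 : ∃ s : {x // x ∈ S}, σ.SameCycle v (α (s : D)) ∧
        (ρ s : D) = (σ ^ 3) (α (s : D))
    · obtain ⟨s, hs, hs3⟩ := h3
      exact Or.inr ⟨⟨s, ⟨hs, hs3⟩, fun t ht =>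
        hρ.eq_of_eq_pow_three hS hα hσ hv ht.1 hs ht.2 hs3⟩, hcases⟩
    · exact Or.inl fun s hs => (hcases s hs).resolve_left fun h => h3 ⟨s, hs, h⟩
end
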